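/- Let A ⊆ ℝⁿ be a bounded closed set with 0 ∈ A ⊆ B₁ and Ω := ℝⁿ \ A. Let u be continuous on the closure of Ω and infinity harmonic in Ω with limsup_{x→∞} |u(x)|/|x| < +∞. Then the functions r ↦ S⁺_r and r ↦ S⁻_r are nondecreasing on (1, ∞). -/

import Mathlib

open Metric Set Filter Bornology Topology
open scoped RealInnerProductSpace

noncomputable section

/-- Euclidean space ℝⁿ. -/
abbrev Euc (n : ℕ) := EuclideanSpace ℝ (Fin n)

/-- Comparison with cones from above (infinity subharmonic). -/
def CmpAbove {n : ℕ} (Ω : Set (Euc n)) (u : Euc n → ℝ) : Prop :=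
  ∀ V : Set (Euc n), IsOpen V → IsBounded V → closure V ⊆ Ω →
    ∀ (x₀ : Euc n) (a b : ℝ),
      (∀ x ∈ frontier (V \ {x₀}), u x ≤ a * ‖x - x₀‖ + b) →
      ∀ x ∈ V, u x ≤ a * ‖x - x₀‖ + b

/-- Comparison with cones from below (infinity superharmonic). -/
def CmpBelow {n : ℕ} (Ω : Set (Euc n)) (u : Euc n → ℝ) : Prop :=
  ∀ V : Set (Euc n), IsOpen V → IsBounded V → closure V ⊆ Ω →
    ∀ (x₀ : Euc n) (a b : ℝ),
      (∀ x ∈ frontier (V \ {x₀}), a * ‖x - x₀‖ + b ≤ u x) →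
      ∀ x ∈ V, a * ‖x - x₀‖ + b ≤ u x

/-- Infinity harmonic = comparison with cones from both sides. -/
def InfHarmonic {n : ℕ} (Ω : Set (Euc n)) (u : Euc n → ℝ) : Prop :=
  CmpAbove Ω u ∧ CmpBelow Ω u

/-- m⁺ = max of u on ∂Ω. -/
def mP {n : ℕ} (Ω : Set (Euc n)) (u : Euc n → ℝ) : ℝ := sSup (u '' frontier Ω)

/-- m⁻ = min of u on ∂Ω. -/
def mM {n : ℕ} (Ω : Set (Euc n)) (u : Euc n → ℝ) : ℝ := sInf (u '' frontier Ω)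

/-- S⁺_r := (max(max_{∂B_r} u, m⁺) − m⁺)/r. -/
def SP {n : ℕ} (Ω : Set (Euc n)) (u : Euc n → ℝ) (r : ℝ) : ℝ :=
  (max (sSup (u '' sphere (0 : Euc n) r)) (mP Ω u) - mP Ω u) / r

/-- S⁻_r := (m⁻ − min(min_{∂B_r} u, m⁻))/r. -/
def SM {n : ℕ} (Ω : Set (Euc n)) (u : Euc n → ℝ) (r : ℝ) : ℝ :=
  (mM Ω u - min (sInf (u '' sphere (0 : Euc n) r)) (mM Ω u)) / r

/-- Lip(u, S) := sup_{x≠y ∈ S} |u(x) − u(y)|/|x − y|. -/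
def lipOn {n : ℕ} (u : Euc n → ℝ) (S : Set (Euc n)) : ℝ :=
  sSup ((fun p : Euc n × Euc n => |u p.1 - u p.2| / ‖p.1 - p.2‖) ''
    {p : Euc n × Euc n | p.1 ∈ S ∧ p.2 ∈ S ∧ p.1 ≠ p.2})

/-- Comparison with a cone of nonnegative slope centred at the origin, on a punctured ball. -/
lemma CmpAbove.le_cone_of_mem_ball {n : ℕ} {A : Set (Euc n)} (hAcl : IsClosed A)
    (h0A : (0 : Euc n) ∈ A) {u : Euc n → ℝ} (hu : ContinuousOn u (closure Aᶜ))
    (hA : CmpAbove Aᶜ u) {s a b : ℝ} (hfr : ∀ x ∈ frontier Aᶜ, u x ≤ a * ‖x‖ + b)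
    (hs : ∀ x ∈ sphere (0 : Euc n) s, u x ≤ a * ‖x‖ + b) :
    ∀ x ∈ ball (0 : Euc n) s, x ∉ A → u x ≤ a * ‖x‖ + b := by
  intro x hx hxA
  refine le_of_forall_pos_le_add fun ε hε => ?_
  by_contra! hlt
  have hopen : IsOpen Aᶜ := hAcl.isOpen_compl
  have hg : ContinuousOn (fun y => u y - (a * ‖y‖ + b + ε)) (closure Aᶜ) :=
    hu.sub (by fun_prop)
  set V : Set (Euc n) :=
    (ball 0 s ∩ Aᶜ) ∩ (fun y => u y - (a * ‖y‖ + b + ε)) ⁻¹' Ioi 0 with hV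
  have hVo : IsOpen V :=
    (hg.mono (inter_subset_right.trans subset_closure)).isOpen_inter_preimage
      (isOpen_ball.inter hopen) isOpen_Ioi
  have hVb : IsBounded V := isBounded_ball.subset fun y hy => hy.1.1
  have hVA : V ⊆ Aᶜ := fun y hy => hy.1.2
  have hcl : ∀ y ∈ closure V, 0 ≤ u y - (a * ‖y‖ + b + ε) := by
    intro y hy
    have hc : ContinuousWithinAt (fun y => u y - (a * ‖y‖ + b + ε)) V y :=
      (hg y (closure_mono hVA hy)).mono (hVA.trans subset_closure)
    have h := hc.mem_closure hy (t := Ioi 0) fun z hz => hz.2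
    rwa [closure_Ioi] at h
  have hclA : closure V ⊆ Aᶜ := by
    intro y hy hyA
    have h1 : y ∈ frontier Aᶜ := by
      rw [hopen.frontier_eq]
      exact ⟨closure_mono hVA hy, fun h => h hyA⟩
    linarith [hfr y h1, hcl y hy]
  have hV0 : V \ {0} = V := sdiff_singleton_eq_self fun h => h.1.2 h0A
  have hbd : ∀ y ∈ frontier (V \ {0}), u y ≤ a * ‖y - 0‖ + (b + ε) := by
    intro y hy
    rw [hV0, hVo.frontier_eq] at hy
    rw [sub_zero]
    have hys : ‖y‖ ≤ s := by
      have h := closure_ball_subset_closedBall (closure_mono (fun z hz => hz.1.1) hy.1)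
      simpa using h
    rcases hys.lt_or_eq with h | h
    · by_contra! hc
      refine hy.2 ⟨⟨by simpa using h, hclA hy.1⟩, ?_⟩
      simp only [mem_preimage, mem_Ioi]
      linarith
    · linarith [hs y (by simpa using h)]
  have hxV : x ∈ V := ⟨⟨hx, hxA⟩, by simp only [mem_preimage, mem_Ioi]; linarith⟩
  have h := hA V hVo hVb hclA 0 a (b + ε) hbd x hxV
  rw [sub_zero] at h
  linarith

lemma monotoneOn_SP {n : ℕ} {A : Set (Euc n)} (hAcl : IsClosed A) (hAbd : IsBounded A)
    (h0A : (0 : Euc n) ∈ A) (hA1 : A ⊆ ball 0 1)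
    {u : Euc n → ℝ} (hu : ContinuousOn u (closure Aᶜ)) (hA : CmpAbove Aᶜ u) :
    MonotoneOn (SP Aᶜ u) (Ioi 1) := by
  intro r hr s hs hrs
  simp only [mem_Ioi] at hr hs
  have hr0 : 0 < r := by linarith
  have hs0 : 0 < s := by linarith
  rcases hrs.eq_or_lt with rfl | hlt
  · rfl
  rcases n.eq_zero_or_pos with rfl | hn
  · have hAu : A = univ := eq_univ_of_forall fun x => Subsingleton.elim 0 x ▸ h0A
    simp [SP, mP, hAu, sphere_eq_empty_of_subsingleton hr0.ne',
      sphere_eq_empty_of_subsingleton hs0.ne']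
  have : Nonempty (Fin n) := ⟨⟨0, hn⟩⟩
  have hsph : ∀ t : ℝ, 1 < t → sphere (0 : Euc n) t ⊆ Aᶜ := by
    intro t ht x hx hxA
    have h1 := hA1 hxA
    simp only [mem_sphere_iff_norm, mem_ball_iff_norm, sub_zero] at hx h1
    linarith
  have hbs : BddAbove (u '' sphere (0 : Euc n) s) :=
    (isCompact_sphere 0 s).bddAbove_image (hu.mono ((hsph s hs).trans subset_closure))
  have hbf : BddAbove (u '' frontier Aᶜ) := by
    refine IsCompact.bddAbove_image ?_ (hu.mono frontier_subset_closure)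
    refine isCompact_of_isClosed_isBounded isClosed_frontier (hAbd.subset ?_)
    rw [frontier_compl]
    exact hAcl.frontier_subset
  have hS0 : 0 ≤ SP Aᶜ u s :=
    div_nonneg (sub_nonneg.2 (le_max_right _ _)) hs0.le
  have hSs : SP Aᶜ u s * s + mP Aᶜ u =
      max (sSup (u '' sphere (0 : Euc n) s)) (mP Aᶜ u) := by
    rw [SP, div_mul_cancel₀ _ hs0.ne', sub_add_cancel]
  have key := hA.le_cone_of_mem_ball hAcl h0A hu (s := s) (a := SP Aᶜ u s) (b := mP Aᶜ u)
    (fun x hx => by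
      have h1 : u x ≤ mP Aᶜ u := le_csSup hbf (mem_image_of_mem u hx)
      have h2 := mul_nonneg hS0 (norm_nonneg x)
      linarith)
    (fun x hx => by
      have h1 := le_csSup hbs (mem_image_of_mem u hx)
      rw [mem_sphere_zero_iff_norm] at hx
      rw [hx, hSs]
      exact h1.trans (le_max_left _ _))
  change (_ - _) / r ≤ _
  rw [div_le_iff₀ hr0, sub_le_iff_le_add]
  refine max_le (csSup_le ?_ ?_) ?_
  · exact (NormedSpace.sphere_nonempty.2 hr0.le).image u
  · rintro _ ⟨x, hx, rfl⟩
    have h := key x (by simpa [mem_sphere_zero_iff_norm.1 hx] using hlt) (hsph r hr hx)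
    rwa [mem_sphere_zero_iff_norm.1 hx] at h
  · exact le_add_of_nonneg_left (mul_nonneg hS0 hr0.le)

lemma CmpBelow.neg {n : ℕ} {Ω : Set (Euc n)} {u : Euc n → ℝ} (h : CmpBelow Ω u) :
    CmpAbove Ω (-u) := by
  intro V hVo hVb hV x₀ a b hfr x hx
  have h1 := h V hVo hVb hV x₀ (-a) (-b)
    (fun y hy => by have := hfr y hy; simp only [Pi.neg_apply] at this; linarith) x hx
  simp only [Pi.neg_apply]
  linarith

lemma SP_neg {n : ℕ} (Ω : Set (Euc n)) (u : Euc n → ℝ) : SP Ω (-u) = SM Ω u := by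
  have him : ∀ T : Set (Euc n), sSup ((-u) '' T) = -sInf (u '' T) := by
    intro T
    rw [Real.sInf_def, neg_neg, ← image_neg_eq_neg, image_image]
    rfl
  funext r
  simp only [SP, SM, mP, mM, him, max_neg_neg]
  ring

/-- S⁺_r and S⁻_r are nondecreasing on (1, ∞). -/
theorem stmt0 {n : ℕ} (A : Set (Euc n)) (hAcl : IsClosed A) (hAbd : IsBounded A)
    (h0A : (0 : Euc n) ∈ A) (hA1 : A ⊆ ball 0 1)
    (u : Euc n → ℝ) (hu : ContinuousOn u (closure Aᶜ)) (hIH : InfHarmonic Aᶜ u)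
    (hgrow : IsBoundedUnder (· ≤ ·) (cobounded (Euc n)) fun x => |u x| / ‖x‖) :
    MonotoneOn (SP Aᶜ u) (Ioi 1) ∧ MonotoneOn (SM Aᶜ u) (Ioi 1) := by
  refine ⟨monotoneOn_SP hAcl hAbd h0A hA1 hu hIH.1, ?_⟩
  rw [← SP_neg]
  exact monotoneOn_SP hAcl hAbd h0A hA1 hu.neg hIH.2.neg
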